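/- (Recursive unlinking realizes (k,2k+2)-splitting.) In the setting of the splitting-by-unlinking proposition, suppose l = 2k + 2. Then after performing the n unlinkings U(i,ι) on the augmented matrix C⁺ (whose extra row has diagonal entry l − 2k − 1 = 1, entry h_s at each spectator and entry k + 1 at each split node), the extra row of the resulting matrix has diagonal entry 1, entry h_s at each old spectator, entry k at each old split node, and entry l − k − 1 = k + 1 at each newly created copy i′. Hence the resulting matrix is itself of the augmented form required by the splitting-by-unlinking procedure, with the n copies i′ as the new designated split nodes, the old split nodes as spectators with shift k, the old spectators retaining their shifts, and the same parameters k and l = 2k + 2; consequently, the unlinking procedure can be iterated, and for every i ≥ 1 the i-th iterate with the extra index deleted equals the i-fold iterated (k,2k+2)-splitting of C (each iteration splitting the n nodes created at the previous step). -/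

import Mathlib

/-- The unlinking `U(i,j)` of a quiver matrix (encoded as a function `ℕ → ℕ → ℤ`),
with the new index placed at the fresh position `ν`. -/
def unlinkAt (ν i j : ℕ) (C : ℕ → ℕ → ℤ) : ℕ → ℕ → ℤ := fun a b =>
  if a = ν then
    if b = ν then C i i + C j j + 2 * C i j - 1
    else if b = i then C i i + C i j - 1
    else if b = j then C j j + C i j - 1
    else C i b + C j b
  else if b = ν then
    if a = i then C i i + C i j - 1
    else if a = j then C j j + C i j - 1
    else C i a + C j a
  else if (a = i ∧ b = j) ∨ (a = j ∧ b = i) then C a b - 1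
  else C a b

/-- One round of `n` unlinkings `U(·,ι)` of the nodes `pb, pb+1, …, pb+n-1` with the
node `ι`, in the order prescribed by `σ` (at time `t` the node `pb + σ t` is unlinked,
the new index being appended at position `nb + t`). -/
def roundUnlink (ι pb nb n : ℕ) (σ : Equiv.Perm (Fin n)) (C : ℕ → ℕ → ℤ) : ℕ → ℕ → ℕ → ℤ
  | 0 => C
  | t + 1 =>
      if h : t < n then
        unlinkAt (nb + t) (pb + ((σ ⟨t, h⟩ : Fin n) : ℕ)) ι (roundUnlink ι pb nb n σ C t)
      else roundUnlink ι pb nb n σ C t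

/-- Iterated rounds of unlinkings with the extra node `ι = s + n`: round `r+1` unlinks
the `n` nodes created in round `r` (the original split nodes `s,…,s+n-1` when `r = 0`)
with `ι`, in the order prescribed by `ords r`, appending the new indices at positions
`s+n+1+rn, …, s+n+1+rn+n-1`. -/
def iterRounds (s n : ℕ) (ords : ℕ → Equiv.Perm (Fin n)) (Cp : ℕ → ℕ → ℤ) :
    ℕ → ℕ → ℕ → ℤ
  | 0 => Cp
  | r + 1 =>
      roundUnlink (s + n) (if r = 0 then s else s + n + 1 + (r - 1) * n)
        (s + n + 1 + r * n) n (ords r) (iterRounds s n ords Cp r) n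

/-- One `(k,l)`-splitting step on a quiver matrix encoded as `ℕ → ℕ → ℤ`: the split
nodes are `b, b+1, …, b+n-1`, the spectators are the indices `< b` with shifts `hsh`,
the copy of the split node `b+u` is placed at `b+n+π(u)`, and the permutation datum of
the splitting assigns the value `σ u` to the split node `b+u`. -/
def splitStep (b n : ℕ) (k l : ℤ) (hsh : ℕ → ℤ) (π : Equiv.Perm (Fin n))
    (σ : Fin n → Fin n) (C : ℕ → ℕ → ℤ) : ℕ → ℕ → ℤ := fun a c =>
  if ha : b + n ≤ a ∧ a < b + n + n then
    let u : Fin n := π.symm ⟨a - (b + n), by omega⟩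
    if hc : b + n ≤ c ∧ c < b + n + n then
      let v : Fin n := π.symm ⟨c - (b + n), by omega⟩
      C (b + (u : ℕ)) (b + (v : ℕ)) + l
    else if hc2 : b ≤ c ∧ c < b + n then
      let v : Fin n := ⟨c - b, by omega⟩
      if v = u then C (b + (u : ℕ)) (b + (u : ℕ)) + k
      else C (b + (u : ℕ)) (b + (v : ℕ)) + (if σ u < σ v then k + 1 else k)
    else C (b + (u : ℕ)) c + hsh c
  else if hc : b + n ≤ c ∧ c < b + n + n then
    let v : Fin n := π.symm ⟨c - (b + n), by omega⟩
    if ha2 : b ≤ a ∧ a < b + n then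
      let u : Fin n := ⟨a - b, by omega⟩
      if u = v then C (b + (v : ℕ)) (b + (v : ℕ)) + k
      else C (b + (u : ℕ)) (b + (v : ℕ)) + (if σ u < σ v then k else k + 1)
    else C a (b + (v : ℕ)) + hsh a
  else C a c

/-- The `i`-fold iterated `(k,l)`-splitting of `C`, each round splitting the `n` nodes
created at the previous round: round `r+1` splits the block `s+rn, …, s+rn+n-1`, the
original spectators keep their shifts `hs0` and all other previous nodes become
spectators with shift `k`; the placement of the copies and the permutation of the
splitting are the ones induced by the unlinking order `ords r` (nodes unlinked earlier
get smaller permutation values, whence `σ = π`). -/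
def iterSplit (s n : ℕ) (k l : ℤ) (hs0 : ℕ → ℤ) (ords : ℕ → Equiv.Perm (Fin n))
    (C : ℕ → ℕ → ℤ) : ℕ → ℕ → ℕ → ℤ
  | 0 => C
  | r + 1 =>
      splitStep (s + r * n) n k l (fun a => if a < s then hs0 a else k)
        (ords r).symm (fun u => (ords r).symm u)
        (iterSplit s n k l hs0 ords C r)

/-- The state reached from `M` after the nodes `p 0, …, p (t - 1)` have been unlinked with `ι`,
the `u`-th new index being `nb + u`. -/
structure UnlinkState (ι nb n : ℕ) (p : Fin n → ℕ) (k : ℤ) (M : ℕ → ℕ → ℤ) (t : ℕ)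
    (R : ℕ → ℕ → ℤ) : Prop where
  symm : ∀ a b, a < nb + t → b < nb + t → R a b = R b a
  old : ∀ a b, a < nb → b < nb → a ≠ ι → b ≠ ι → R a b = M a b
  extra_diag : R ι ι = M ι ι
  extra_spectator : ∀ a, a < nb → a ≠ ι → (∀ u, p u ≠ a) → R ι a = M ι a
  extra_split : ∀ u : Fin n, R ι (p u) = if (u : ℕ) < t then k else k + 1
  extra_copy : ∀ u : Fin n, (u : ℕ) < t → R ι (nb + u) = M ι ι + k
  copy_spectator : ∀ u : Fin n, (u : ℕ) < t → ∀ a, a < nb → a ≠ ι → (∀ v, p v ≠ a) →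
    R (nb + u) a = M (p u) a + M ι a
  copy_split : ∀ u : Fin n, (u : ℕ) < t → ∀ v : Fin n,
    R (nb + u) (p v) = M (p u) (p v) + if u < v then k + 1 else k
  copy_copy : ∀ u v : Fin n, (u : ℕ) < t → (v : ℕ) < t →
    R (nb + u) (nb + v) = M (p u) (p v) + (M ι ι + 2 * k + 1)

theorem UnlinkState.zero {ι nb n : ℕ} {p : Fin n → ℕ} {k : ℤ} {M : ℕ → ℕ → ℤ}
    (hM : ∀ a b, a < nb → b < nb → M a b = M b a)
    (hk : ∀ u, M ι (p u) = k + 1) : UnlinkState ι nb n p k M 0 M := by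
  constructor <;> simp_all

theorem UnlinkState.succ {ι nb n : ℕ} {p : Fin n → ℕ} {k : ℤ} {M R : ℕ → ℕ → ℤ} {t : ℕ}
    (hι : ι < nb) (hp : ∀ u, p u < nb) (hpι : ∀ u, p u ≠ ι) (hinj : Function.Injective p)
    (hM : ∀ a b, a < nb → b < nb → M a b = M b a) (ht : t < n)
    (h : UnlinkState ι nb n p k M t R) :
    UnlinkState ι nb n p k M (t + 1) (unlinkAt (nb + t) (p ⟨t, ht⟩) ι R) := by
  obtain ⟨hsymm, hold, hed, hes, hep, hec, hcs, hcp, hcc⟩ := h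
  have hpt := hp ⟨t, ht⟩
  have hptι := hpι ⟨t, ht⟩
  have hι_p : R (p ⟨t, ht⟩) ι = k + 1 := by
    rw [hsymm _ _ (by omega) (by omega), hep]; simp
  have hne : ∀ v : Fin n, (v : ℕ) ≠ t → p v ≠ p ⟨t, ht⟩ := fun v hv h =>
    hv (congrArg Fin.val (hinj h))
  have heq : ∀ v : Fin n, (v : ℕ) = t → v = ⟨t, ht⟩ := fun v hv => Fin.ext hv
  refine ⟨?_, ?_, ?_, ?_, ?_, ?_, ?_, ?_, ?_⟩
  · intro a b ha hb
    simp only [unlinkAt]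
    have := hsymm a b
    grind
  · intro a b ha hb haι hbι
    simp only [unlinkAt]
    have := hold a b ha hb haι hbι
    grind
  · simp only [unlinkAt]
    grind
  · intro a ha haι hap
    simp only [unlinkAt]
    have := hes a ha haι hap
    have := hap ⟨t, ht⟩
    grind
  · intro u
    have := hep u
    have := hp u
    have := hpι u
    rcases eq_or_ne (u : ℕ) t with hu | hu
    · obtain rfl := heq u hu
      simp only [unlinkAt]
      grind
    · have := hne u hu
      simp only [unlinkAt]
      grind
  · intro u hu
    rcases eq_or_ne (u : ℕ) t with hu' | hu'
    · obtain rfl := heq u hu'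
      simp only [unlinkAt]
      grind
    · have := hec u (by omega)
      simp only [unlinkAt]
      grind
  · intro u hu a ha haι hap
    have := hap ⟨t, ht⟩
    rcases eq_or_ne (u : ℕ) t with hu' | hu'
    · obtain rfl := heq u hu'
      have := hes a ha haι hap
      have := hold _ a hpt ha hptι haι
      simp only [unlinkAt]
      grind
    · have := hcs u (by omega) a ha haι hap
      simp only [unlinkAt]
      grind
  · intro u hu v
    have := hp v
    have := hpι v
    have := hold _ _ hpt (hp v) hptι (hpι v)
    have := hep v
    rcases eq_or_ne (u : ℕ) t with hu' | hu'
    · obtain rfl := heq u hu'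
      simp only [unlinkAt, Fin.lt_def]
      rcases eq_or_ne (v : ℕ) t with hv | hv
      · obtain rfl := heq v hv
        grind
      · have := hne v hv
        grind
    · have := hcp u (by omega) v
      simp only [unlinkAt]
      grind
  · intro u v hu hv
    rcases eq_or_ne (u : ℕ) t with hu' | hu' <;> rcases eq_or_ne (v : ℕ) t with hv' | hv'
    · obtain rfl := heq u hu'
      obtain rfl := heq v hv'
      have := hold _ _ hpt hpt hptι hptι
      simp only [unlinkAt]
      grind
    · obtain rfl := heq u hu'
      have h1 := hcp v (by omega) ⟨t, ht⟩
      rw [if_pos (Fin.lt_def.2 (by simp only; omega)), hM _ _ (hp _) (hp _)] at h1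
      have h2 := hec v (by omega)
      have h3 := hsymm (p ⟨t, ht⟩) (nb + v) (by omega) (by omega)
      simp only [unlinkAt]
      grind
    · obtain rfl := heq v hv'
      have h1 := hcp u (by omega) ⟨t, ht⟩
      rw [if_pos (Fin.lt_def.2 (by simp only; omega))] at h1
      have h2 := hec u (by omega)
      have h3 := hsymm (p ⟨t, ht⟩) (nb + u) (by omega) (by omega)
      simp only [unlinkAt]
      grind
    · have := hcc u v (by omega) (by omega)
      simp only [unlinkAt]
      grind

theorem roundUnlink_state {ι pb nb n : ℕ} {σ : Equiv.Perm (Fin n)} {k : ℤ} {M : ℕ → ℕ → ℤ}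
    (hι : ι < nb) (hpb : pb + n ≤ nb) (hιpb : ι < pb ∨ pb + n ≤ ι)
    (hM : ∀ a b, a < nb → b < nb → M a b = M b a)
    (hk : ∀ u : Fin n, M ι (pb + u) = k + 1) :
    ∀ t ≤ n, UnlinkState ι nb n (fun u => pb + (σ u : ℕ)) k M t (roundUnlink ι pb nb n σ M t)
  | 0, _ => .zero hM fun u => hk (σ u)
  | t + 1, ht => by
    have ht' : t < n := ht
    rw [roundUnlink, dif_pos ht']
    refine UnlinkState.succ (p := fun u => pb + (σ u : ℕ)) hι (fun u => by omega) (fun u => by omega)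
      (fun u v h => ?_) hM ht' (roundUnlink_state hι hpb hιpb hM hk t ht'.le)
    simpa [Fin.val_inj] using h

section SplitStep

variable {b n : ℕ} {k l : ℤ} {hsh : ℕ → ℤ} {σ : Equiv.Perm (Fin n)} {C : ℕ → ℕ → ℤ}

theorem splitStep_old {a c : ℕ} (ha : a < b + n) (hc : c < b + n) (π : Equiv.Perm (Fin n))
    (τ : Fin n → Fin n) : splitStep b n k l hsh π τ C a c = C a c := by
  simp only [splitStep]
  rw [dif_neg (by omega), dif_neg (by omega)]

theorem splitStep_copy_copy (i j : Fin n) (τ : Fin n → Fin n) :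
    splitStep b n k l hsh σ.symm τ C (b + n + i) (b + n + j) = C (b + σ i) (b + σ j) + l := by
  simp [splitStep]

theorem splitStep_copy_split (i j : Fin n) :
    splitStep b n k l hsh σ.symm (fun u => σ.symm u) C (b + n + i) (b + σ j) =
      C (b + σ i) (b + σ j) + if i < j then k + 1 else k := by
  have := (σ j).isLt
  simp only [splitStep]
  rw [dif_pos (by omega), dif_neg (by omega), dif_pos (by omega)]
  by_cases h : j = i
  · simp [h]
  · simp [h]

theorem splitStep_split_copy (hC : ∀ a c, a < b + n → c < b + n → C a c = C c a)
    (i j : Fin n) :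
    splitStep b n k l hsh σ.symm (fun u => σ.symm u) C (b + σ j) (b + n + i) =
      C (b + σ i) (b + σ j) + if i < j then k + 1 else k := by
  have := (σ j).isLt
  rw [hC _ _ (by omega) (by omega)]
  simp only [splitStep]
  rw [dif_neg (by omega), dif_pos (by omega), dif_pos (by omega)]
  by_cases h : j = i
  · simp [h]
  · have : (i < j) ↔ ¬ (j < i) := by omega
    by_cases h' : j < i <;> simp [h, h', this]

theorem splitStep_copy_spectator (i : Fin n) {c : ℕ} (hc : c < b) (τ : Fin n → Fin n) :
    splitStep b n k l hsh σ.symm τ C (b + n + i) c = C (b + σ i) c + hsh c := by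
  simp only [splitStep]
  rw [dif_pos (by omega), dif_neg (by omega), dif_neg (by omega)]
  simp

theorem splitStep_spectator_copy (hC : ∀ a c, a < b + n → c < b + n → C a c = C c a)
    (i : Fin n) {c : ℕ} (hc : c < b) (τ : Fin n → Fin n) :
    splitStep b n k l hsh σ.symm τ C c (b + n + i) = C (b + σ i) c + hsh c := by
  rw [hC _ _ (by omega) (by omega)]
  simp only [splitStep]
  rw [dif_neg (by omega), dif_pos (by omega), dif_neg (by omega)]
  simp

end SplitStep

/-- The position, in a matrix with the extra index `ι`, of the index `a` of the matrix with `ι`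
deleted. -/
def skipIndex (ι a : ℕ) : ℕ := if a < ι then a else a + 1

/-- `M` is the augmented form of the quiver matrix `S` on `B + n` nodes, the last `n` of which are
split nodes, for the parameters `k` and `l = 2 * k + 2`. -/
structure IsAugmented (ι B n : ℕ) (k : ℤ) (hsh : ℕ → ℤ) (S M : ℕ → ℕ → ℤ) : Prop where
  symm : ∀ a b, a < B + n + 1 → b < B + n + 1 → M a b = M b a
  delete : ∀ a b, a < B + n → b < B + n → M (skipIndex ι a) (skipIndex ι b) = S a b
  extra_diag : M ι ι = 1
  extra_spectator : ∀ a < B, M ι (skipIndex ι a) = hsh a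
  extra_split : ∀ u : Fin n, M ι (skipIndex ι (B + u)) = k + 1

theorem IsAugmented.round {ι pb B n : ℕ} {k l : ℤ} {hsh : ℕ → ℤ} {S M : ℕ → ℕ → ℤ}
    (h : IsAugmented ι B n k hsh S M) (hl : l = 2 * k + 2) (hι : ι ≤ B + n)
    (hpb : pb + n ≤ B + n + 1) (hιpb : ι < pb ∨ pb + n ≤ ι)
    (hskip : ∀ u < n, skipIndex ι (B + u) = pb + u) (σ : Equiv.Perm (Fin n)) :
    IsAugmented ι (B + n) n k (fun a => if a < B then hsh a else k)
      (splitStep B n k l hsh σ.symm (fun u => σ.symm u) S)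
      (roundUnlink ι pb (B + n + 1) n σ M n) := by
  have hR := roundUnlink_state (σ := σ) (k := k) (by omega : ι < B + n + 1) hpb hιpb h.symm
    (fun u => by rw [← hskip u u.isLt]; exact h.extra_split u) n le_rfl
  have hSsymm : ∀ a c, a < B + n → c < B + n → S a c = S c a := fun a c ha hc => by
    rw [← h.delete a c ha hc, ← h.delete c a hc ha]
    apply h.symm <;> simp only [skipIndex] <;> split_ifs <;> omega
  have hnew : ∀ u : ℕ, skipIndex ι (B + n + u) = B + n + 1 + u := fun u => by
    simp only [skipIndex]; split_ifs <;> omega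
  have hlt : ∀ a < B + n, skipIndex ι a < B + n + 1 := fun a ha => by
    simp only [skipIndex]; split_ifs <;> omega
  have hne : ∀ a, skipIndex ι a ≠ ι := fun a => by
    simp only [skipIndex]; split_ifs <;> omega
  have hinj : Function.Injective (skipIndex ι) := fun a c hac => by
    simp only [skipIndex] at hac; split_ifs at hac <;> omega
  have hspec : ∀ a < B, ∀ u, pb + (σ u : ℕ) ≠ skipIndex ι a := fun a ha u hu => by
    rw [← hskip _ (σ u).isLt] at hu
    have := hinj hu
    omega
  have hcases : ∀ a < B + n, a < B ∨ ∃ u : Fin n, a = B + σ u := fun a ha => by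
    by_cases haB : a < B
    · exact .inl haB
    · exact .inr ⟨σ.symm ⟨a - B, by omega⟩, by simp; omega⟩
  have hcases' : ∀ a < B + n + n, a < B + n ∨ ∃ u : Fin n, a = B + n + u := fun a ha => by
    by_cases haB : a < B + n
    · exact .inl haB
    · exact .inr ⟨⟨a - (B + n), by omega⟩, by simp; omega⟩
  have hrow : ∀ (u : Fin n) (c : ℕ), c < B + n →
      roundUnlink ι pb (B + n + 1) n σ M n (B + n + 1 + u) (skipIndex ι c) =
        splitStep B n k l hsh σ.symm (fun u => σ.symm u) S (B + n + u) c ∧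
      splitStep B n k l hsh σ.symm (fun u => σ.symm u) S c (B + n + u) =
        splitStep B n k l hsh σ.symm (fun u => σ.symm u) S (B + n + u) c := by
    intro u c hc
    obtain hcB | ⟨v, rfl⟩ := hcases c hc
    · rw [splitStep_copy_spectator u hcB, splitStep_spectator_copy hSsymm u hcB,
        hR.copy_spectator u u.isLt _ (hlt c hc) (hne c) (hspec c hcB),
        h.extra_spectator c hcB, ← hskip _ (σ u).isLt, h.delete _ _ (by omega) hc]
      exact ⟨rfl, rfl⟩
    · rw [splitStep_copy_split, splitStep_split_copy hSsymm, hskip _ (σ v).isLt,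
        hR.copy_split u u.isLt v, ← hskip _ (σ u).isLt, ← hskip _ (σ v).isLt,
        h.delete _ _ (by omega) hc]
      exact ⟨rfl, rfl⟩
  refine ⟨fun a c ha hc => hR.symm a c (by omega) (by omega), ?_, ?_, ?_, ?_⟩
  · intro a c ha hc
    obtain haB | ⟨u, rfl⟩ := hcases' a ha <;> obtain hcB | ⟨v, rfl⟩ := hcases' c hc
    · rw [splitStep_old haB hcB, hR.old _ _ (hlt a haB) (hlt c hcB) (hne a) (hne c),
        h.delete a c haB hcB]
    · have := hlt a haB
      rw [hnew, (hrow v a haB).2, ← (hrow v a haB).1, hR.symm _ _ (by omega) (by omega)]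
    · rw [hnew, (hrow u c hcB).1]
    · rw [hnew, hnew, splitStep_copy_copy, hR.copy_copy u v u.isLt v.isLt, h.extra_diag,
        ← hskip _ (σ u).isLt, ← hskip _ (σ v).isLt, h.delete _ _ (by omega) (by omega), hl]
      ring
  · rw [hR.extra_diag, h.extra_diag]
  · intro a ha
    obtain haB | ⟨u, rfl⟩ := hcases a ha
    · rw [if_pos haB, hR.extra_spectator _ (hlt a ha) (hne a) (hspec a haB),
        h.extra_spectator a haB]
    · rw [if_neg (by omega), hskip _ (σ u).isLt, hR.extra_split u, if_pos u.isLt]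
  · intro u
    rw [hnew, hR.extra_copy u u.isLt, h.extra_diag, add_comm]

theorem IsAugmented.congr_shift {ι B n : ℕ} {k : ℤ} {f g : ℕ → ℤ} {S M : ℕ → ℕ → ℤ}
    (h : IsAugmented ι B n k f S M) (hfg : ∀ a < B, f a = g a) : IsAugmented ι B n k g S M :=
  ⟨h.symm, h.delete, h.extra_diag, fun a ha => by rw [h.extra_spectator a ha, hfg a ha],
    h.extra_split⟩

theorem isAugmented_iterRounds {s n : ℕ} {k l : ℤ} {hs0 : ℕ → ℤ} {C Cp : ℕ → ℕ → ℤ}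
    (hl : l = 2 * k + 2) (ords : ℕ → Equiv.Perm (Fin n))
    (h0 : IsAugmented (s + n) s n k hs0 C Cp) :
    ∀ r, IsAugmented (s + n) (s + r * n) n k (fun a => if a < s then hs0 a else k)
      (iterSplit s n k l hs0 ords C r) (iterRounds s n ords Cp r)
  | 0 => by
    rw [Nat.zero_mul]
    exact h0.congr_shift fun a ha => (if_pos ha).symm
  | r + 1 => by
    have hr : s + n + 1 + r * n = s + r * n + n + 1 := by ring
    have hr' : s + (r + 1) * n = s + r * n + n := by ring
    rw [iterRounds, iterSplit, hr, hr']
    refine ((isAugmented_iterRounds hl ords h0 r).round hl (by omega) ?_ ?_ ?_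
      (ords r)).congr_shift ?_
    · rcases r with _ | r
      · simp
      · have : (r + 1) * n = r * n + n := by ring
        simp; omega
    · rcases r with _ | r
      · simp
      · simp; omega
    · intro u hu
      rcases r with _ | r
      · simp [skipIndex, hu]
      · have : (r + 1) * n = r * n + n := by ring
        simp [skipIndex]; grind
    · intro a ha
      split_ifs <;> first | rfl | omega

/-- **Recursive unlinking realizes `(k,2k+2)`-splitting.**  In the
splitting-by-unlinking setting with `l = 2k + 2`, after one round of the `n`
unlinkings `U(i,ι)` on the augmented matrix `C⁺` (extra row: diagonal
`l - 2k - 1 = 1`, `hs0` at spectators, `k + 1` at split nodes), the extra row of the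
result has diagonal `1`, entries `hs0` at the old spectators, `k` at the old split
nodes and `l - k - 1 = k + 1` at the new copies; hence the result is again of the
augmented form and the procedure iterates: for every `i ≥ 1` the `i`-th iterate with
the extra index `ι = s+n` deleted equals the `i`-fold iterated `(k,2k+2)`-splitting of
`C`, each iteration splitting the `n` nodes created at the previous step. -/
theorem recursive_unlinking_realizes_splitting
    (s n : ℕ) (C : ℕ → ℕ → ℤ)
    (hsym : ∀ a b, a < s + n → b < s + n → C a b = C b a)
    (hs0 : ℕ → ℤ) (k l : ℤ) (hl : l = 2 * k + 2)
    (ords : ℕ → Equiv.Perm (Fin n)) :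
    let ι := s + n
    let Cplus : ℕ → ℕ → ℤ := fun a b =>
      if a = ι then (if b = ι then l - 2 * k - 1 else if b < s then hs0 b else k + 1)
      else if b = ι then (if a < s then hs0 a else k + 1)
      else C a b
    let F1 := iterRounds s n ords Cplus 1
    let cp0 : Fin n → ℕ := fun i => s + n + 1 + (((ords 0).symm i : Fin n) : ℕ)
    -- (a) the extra row after one round of unlinkings:
    (F1 ι ι = l - 2 * k - 1 ∧
     (∀ a, a < s → F1 ι a = hs0 a) ∧
     (∀ i : Fin n, F1 ι (s + (i : ℕ)) = k) ∧
     (∀ i : Fin n, F1 ι (cp0 i) = l - k - 1)) ∧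
    -- (b) the iterated unlinking with ι deleted is the iterated (k,2k+2)-splitting:
    (∀ i : ℕ, 1 ≤ i → ∀ a b : ℕ, a < s + n + i * n → b < s + n + i * n →
      iterRounds s n ords Cplus i (if a < s + n then a else a + 1)
          (if b < s + n then b else b + 1) =
        iterSplit s n k l hs0 ords C i a b) := by
  intro ι Cplus F1 cp0
  have h0 : IsAugmented ι s n k hs0 C Cplus := by
    refine ⟨?_, ?_, ?_, ?_, ?_⟩
    · intro a b ha hb
      have := hsym a b
      simp only [Cplus]
      grind
    · intro a b ha hb
      have ha' : a < ι := ha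
      have hb' : b < ι := hb
      simp [Cplus, skipIndex, ha', hb', ha'.ne, hb'.ne]
    · simp only [Cplus, if_true]
      omega
    · intro a ha
      have ha' : a < ι := by omega
      simp [Cplus, skipIndex, ha', ha'.ne, ha]
    · intro u
      have hu : s + (u : ℕ) < ι := by omega
      simp [Cplus, skipIndex, hu, hu.ne]
  have hiter := isAugmented_iterRounds hl ords h0
  have h1 := hiter 1
  rw [Nat.one_mul] at h1
  refine ⟨⟨?_, ?_, ?_, ?_⟩, ?_⟩
  · rw [show F1 ι ι = 1 from h1.extra_diag]
    omega
  · intro a ha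
    have := h1.extra_spectator a (by omega)
    rwa [skipIndex, if_pos (by omega), if_pos ha] at this
  · intro i
    have := h1.extra_spectator (s + i) (by omega)
    rwa [skipIndex, if_pos (by omega), if_neg (by omega)] at this
  · intro i
    have := h1.extra_split ((ords 0).symm i)
    rw [skipIndex, if_neg (by omega)] at this
    rw [Nat.add_right_comm] at this
    rw [show F1 ι (cp0 i) = k + 1 from this]
    omega
  · intro i _ a b ha hb
    exact (hiter i).delete a b (by omega) (by omega)
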